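/- arXiv:1111.0809 — 4 statements merged into one kernel-verified Lean document; each statement's English description precedes it below -/
import Mathlib

section
/- Let σ ∈ L²_unif(ℝ) and τ ∈ L¹_unif(ℝ) be real-valued and set q := σ' + τ (a distribution on ℝ). If r ∈ L²_loc(ℝ) is real-valued and satisfies the Riccati equation r' + r² = q in the distributional sense (i.e. −∫ r φ' + ∫ r² φ = −∫ σ φ' + ∫ τ φ for every φ ∈ C_c^∞(ℝ), where the pairings extend continuously to compactly supported φ ∈ W¹₂), then r ∈ L²_unif(ℝ). -/
open MeasureTheory Set Filter Topology intervalIntegral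

noncomputable section

/-- `φ` is a test function on `ℝ`: smooth with compact support. -/
def IsTest (φ : ℝ → ℝ) : Prop := ContDiff ℝ (⊤ : ℕ∞) φ ∧ HasCompactSupport φ

/-- `r ∈ L²_loc(ℝ)`: `r` is measurable and square integrable on every compact interval. -/
def LocL2 (r : ℝ → ℝ) : Prop :=
  Measurable r ∧ ∀ a b : ℝ, IntegrableOn (fun t => r t ^ 2) (Set.Icc a b) volume

/-- `σ ∈ L²_unif(ℝ)`: measurable, square integrable on every interval `[t, t+1]`,
with `sup_t ∫_t^{t+1} σ² < ∞`. -/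
def MemL2unif (σ : ℝ → ℝ) : Prop :=
  Measurable σ ∧
  (∀ t : ℝ, IntegrableOn (fun s => σ s ^ 2) (Set.Icc t (t + 1)) volume) ∧
  ∃ M : ℝ, ∀ t : ℝ, (∫ s in Set.Icc t (t + 1), σ s ^ 2) ≤ M

/-- `τ ∈ L¹_unif(ℝ)`: measurable, integrable on every interval `[t, t+1]`,
with `sup_t ∫_t^{t+1} |τ| < ∞`. -/
def MemL1unif (τ : ℝ → ℝ) : Prop :=
  Measurable τ ∧
  (∀ t : ℝ, IntegrableOn τ (Set.Icc t (t + 1)) volume) ∧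
  ∃ M : ℝ, ∀ t : ℝ, (∫ s in Set.Icc t (t + 1), |τ s|) ≤ M

/-- A uniform bound on unit intervals gives a bound on intervals of length three. -/
lemma unif_three (g : ℝ → ℝ) (M : ℝ)
    (hi : ∀ t : ℝ, IntegrableOn g (Set.Icc t (t + 1)) volume)
    (hM : ∀ t : ℝ, (∫ s in Set.Icc t (t + 1), g s) ≤ M) (t : ℝ) :
    IntegrableOn g (Set.Icc (t - 1) (t + 2)) volume ∧
      (∫ s in Set.Icc (t - 1) (t + 2), g s) ≤ 3 * M := by
  have hii : ∀ a : ℝ, IntervalIntegrable g volume a (a + 1) := fun a =>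
    (intervalIntegrable_iff_integrableOn_Icc_of_le (by linarith)).2 (hi a)
  have hb : ∀ a : ℝ, (∫ s in a..(a + 1), g s) ≤ M := fun a => by
    rw [intervalIntegral.integral_of_le (by linarith), ← integral_Icc_eq_integral_Ioc]
    exact hM a
  have h1 := hii (t - 1)
  have h2 := hii t
  have h3 := hii (t + 1)
  have b1 := hb (t - 1)
  have b2 := hb t
  have b3 := hb (t + 1)
  rw [show t - 1 + 1 = t by ring] at h1 b1
  rw [show t + 1 + 1 = t + 2 by ring] at h3 b3
  refine ⟨(intervalIntegrable_iff_integrableOn_Icc_of_le (by linarith)).1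
    ((h1.trans h2).trans h3), ?_⟩
  rw [integral_Icc_eq_integral_Ioc, ← intervalIntegral.integral_of_le (by linarith),
    ← intervalIntegral.integral_add_adjacent_intervals (h1.trans h2) h3,
    ← intervalIntegral.integral_add_adjacent_intervals h1 h2]
  linarith

/-- A measurable function whose square is integrable on a compact interval is integrable. -/
lemma integrableOn_of_sq (f : ℝ → ℝ) (hf : Measurable f) (a b : ℝ)
    (h : IntegrableOn (fun t => f t ^ 2) (Set.Icc a b) volume) :
    IntegrableOn f (Set.Icc a b) volume := by
  have h1 : IntegrableOn (fun _ : ℝ => (1 : ℝ)) (Set.Icc a b) volume :=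
    integrableOn_const (by simp)
  refine Integrable.mono' (h1.add h) hf.aestronglyMeasurable (ae_of_all _ fun x => ?_)
  simp only [Pi.add_apply, Real.norm_eq_abs]
  nlinarith [sq_abs (f x), sq_nonneg (|f x| - 1), abs_nonneg (f x)]

/-- A smooth cut-off with a bounded derivative. -/
lemma exists_cutoff : ∃ (C : ℝ), ∀ t : ℝ, ∃ ψ : ℝ → ℝ, ContDiff ℝ (⊤ : ℕ∞) ψ ∧
    (∀ x, 0 ≤ ψ x) ∧ (∀ x, ψ x ≤ 1) ∧ (∀ x ∈ Set.Icc t (t + 1), ψ x = 1) ∧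
    (∀ x, x ∉ Set.Icc (t - 1) (t + 2) → ψ x = 0) ∧ (∀ x, deriv ψ x ^ 2 ≤ C) := by
  let f : ContDiffBump (0 : ℝ) := ⟨1 / 2, 3 / 2, by norm_num, by norm_num⟩
  have hf : ContDiff ℝ (⊤ : ℕ∞) f := f.contDiff
  have hc : Continuous (deriv f) := hf.continuous_deriv (by simp)
  obtain ⟨C, hC⟩ := hc.bounded_above_of_compact_support f.hasCompactSupport.deriv
  refine ⟨C ^ 2, fun t => ⟨fun x => f (x - (t + 1 / 2)), ?_, fun x => f.nonneg, fun x => f.le_one,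
    ?_, ?_, ?_⟩⟩
  · exact hf.comp (contDiff_id.sub contDiff_const)
  · intro x hx
    apply f.one_of_mem_closedBall
    simp only [Metric.mem_closedBall, Real.dist_eq, f, abs_le]
    constructor <;> linarith [hx.1, hx.2]
  · intro x hx
    apply f.zero_of_le_dist
    simp only [Real.dist_eq, f]
    by_contra! h
    rw [abs_lt] at h
    exact hx ⟨by linarith [h.1], by linarith [h.2]⟩
  · intro x
    rw [deriv_comp_sub_const]
    have := hC (x - (t + 1 / 2))
    rw [Real.norm_eq_abs] at this
    rw [← sq_abs]
    gcongr

/-- If `q = σ' + τ` with real-valued `σ ∈ L²_unif(ℝ)` and `τ ∈ L¹_unif(ℝ)`, and a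
real-valued `r ∈ L²_loc(ℝ)` satisfies the Riccati equation `r' + r² = q` in the
distributional sense (`-∫ r φ' + ∫ r² φ = -∫ σ φ' + ∫ τ φ` for every test function `φ`),
then `r ∈ L²_unif(ℝ)`. -/
theorem riccati_solution_L2unif (σ τ r : ℝ → ℝ)
    (hσ : MemL2unif σ) (hτ : MemL1unif τ) (hr : LocL2 r)
    (hricc : ∀ φ : ℝ → ℝ, IsTest φ →
      -(∫ x : ℝ, r x * deriv φ x) + ∫ x : ℝ, r x ^ 2 * φ x
        = -(∫ x : ℝ, σ x * deriv φ x) + ∫ x : ℝ, τ x * φ x) :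
    MemL2unif r := by
  obtain ⟨C, hC⟩ := exists_cutoff
  obtain ⟨hσm, hσi, M₁, hM₁⟩ := hσ
  obtain ⟨hτm, hτi, M₂, hM₂⟩ := hτ
  obtain ⟨hrm, hri⟩ := hr
  refine ⟨hrm, fun t => hri _ _, 2 * (9 * C + 3 * M₁ + 3 * M₂), fun t => ?_⟩
  obtain ⟨ψ, hψ, h0, h1, hone, hzero, hd⟩ := hC t
  obtain ⟨hσ2, hσb⟩ := unif_three _ _ hσi hM₁ t
  obtain ⟨hτ1, hτb⟩ := unif_three (fun s => |τ s|) _ (fun t => (hτi t).abs) hM₂ t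
  have hτS : IntegrableOn τ (Set.Icc (t - 1) (t + 2)) volume :=
    (integrable_norm_iff hτm.aestronglyMeasurable).1 hτ1
  have hr2 := hri (t - 1) (t + 2)
  have hr1 := integrableOn_of_sq r hrm _ _ hr2
  have hσ1 := integrableOn_of_sq σ hσm _ _ hσ2
  set S := Set.Icc (t - 1) (t + 2) with hS
  have hSc : IsCompact S := isCompact_Icc
  have hdiff : Differentiable ℝ ψ := hψ.differentiable (by simp)
  have hdc : Continuous (deriv ψ) := hψ.continuous_deriv (by simp)
  have hder : ∀ x, deriv (fun y => ψ y ^ 2) x = 2 * ψ x * deriv ψ x := fun x => by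
    have := ((hdiff x).hasDerivAt.pow 2).deriv
    simpa [Pi.pow_def] using this
  have htest : IsTest (fun y => ψ y ^ 2) :=
    ⟨hψ.pow 2, HasCompactSupport.intro hSc fun x hx => by simp [hzero x hx]⟩
  have key := hricc _ htest
  simp only [hder] at key
  have cut : ∀ g : ℝ → ℝ, (∀ x, x ∉ S → g x = 0) → ∫ x, g x = ∫ x in S, g x := fun g hg =>
    (setIntegral_eq_integral_of_forall_compl_eq_zero hg).symm
  rw [cut (fun x => r x * (2 * ψ x * deriv ψ x)) (fun x hx => by simp [hzero x hx]),
    cut (fun x => r x ^ 2 * ψ x ^ 2) (fun x hx => by simp [hzero x hx]),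
    cut (fun x => σ x * (2 * ψ x * deriv ψ x)) (fun x hx => by simp [hzero x hx]),
    cut (fun x => τ x * ψ x ^ 2) (fun x hx => by simp [hzero x hx])] at key
  have c1 : Continuous (fun x => 2 * ψ x * deriv ψ x) := by fun_prop
  have c2 : Continuous (fun x => ψ x ^ 2) := by fun_prop
  have i1 : IntegrableOn (fun x => r x * (2 * ψ x * deriv ψ x)) S volume :=
    hr1.mul_continuousOn c1.continuousOn hSc
  have i2 : IntegrableOn (fun x => r x ^ 2 * ψ x ^ 2) S volume :=
    hr2.mul_continuousOn c2.continuousOn hSc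
  have i3 : IntegrableOn (fun x => σ x * (2 * ψ x * deriv ψ x)) S volume :=
    hσ1.mul_continuousOn c1.continuousOn hSc
  have i4 : IntegrableOn (fun x => τ x * ψ x ^ 2) S volume :=
    hτS.mul_continuousOn c2.continuousOn hSc
  have ic : IntegrableOn (fun _ : ℝ => 3 * C) S volume := integrableOn_const (by simp [hS])
  have hmono : (∫ x in S, (r x * (2 * ψ x * deriv ψ x) - σ x * (2 * ψ x * deriv ψ x)
      + τ x * ψ x ^ 2)) ≤
      ∫ x in S, ((1 / 2) * (r x ^ 2 * ψ x ^ 2) + 3 * C + σ x ^ 2 + |τ x|) := by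
    refine setIntegral_mono ((i1.sub i3).add i4)
      ((((i2.const_mul (1 / 2)).add ic).add hσ2).add hτ1) fun x => ?_
    have hp : ψ x ^ 2 ≤ 1 := pow_le_one₀ (h0 x) (h1 x)
    have e1 : r x * (2 * ψ x * deriv ψ x) ≤ (1 / 2) * (r x ^ 2 * ψ x ^ 2) + 2 * C := by
      nlinarith [sq_nonneg (r x * ψ x - 2 * deriv ψ x), hd x]
    have e2 : -(σ x * (2 * ψ x * deriv ψ x)) ≤ σ x ^ 2 + C := by
      nlinarith [sq_nonneg (σ x * ψ x + deriv ψ x), hd x,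
        mul_le_mul_of_nonneg_left hp (sq_nonneg (σ x))]
    have e3 : τ x * ψ x ^ 2 ≤ |τ x| := by
      calc τ x * ψ x ^ 2 ≤ |τ x| * ψ x ^ 2 := by gcongr; exact le_abs_self _
        _ ≤ |τ x| * 1 := by gcongr
        _ = |τ x| := mul_one _
    show r x * (2 * ψ x * deriv ψ x) - σ x * (2 * ψ x * deriv ψ x) + τ x * ψ x ^ 2 ≤
      (1 / 2) * (r x ^ 2 * ψ x ^ 2) + 3 * C + σ x ^ 2 + |τ x|
    linarith
  have eL : (∫ x in S, (r x * (2 * ψ x * deriv ψ x) - σ x * (2 * ψ x * deriv ψ x)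
      + τ x * ψ x ^ 2)) = (∫ x in S, r x * (2 * ψ x * deriv ψ x))
      - (∫ x in S, σ x * (2 * ψ x * deriv ψ x)) + ∫ x in S, τ x * ψ x ^ 2 := by
    have j : IntegrableOn (fun x => r x * (2 * ψ x * deriv ψ x) - σ x * (2 * ψ x * deriv ψ x))
      S volume := i1.sub i3
    rw [integral_add j i4, integral_sub i1 i3]
  have eR : (∫ x in S, ((1 / 2) * (r x ^ 2 * ψ x ^ 2) + 3 * C + σ x ^ 2 + |τ x|)) =
      (1 / 2) * (∫ x in S, r x ^ 2 * ψ x ^ 2) + 9 * C + (∫ x in S, σ x ^ 2)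
      + ∫ x in S, |τ x| := by
    have j : IntegrableOn (fun x => (1 / 2) * (r x ^ 2 * ψ x ^ 2) + 3 * C) S volume :=
      (i2.const_mul (1 / 2)).add ic
    have k : IntegrableOn (fun x => (1 / 2) * (r x ^ 2 * ψ x ^ 2) + 3 * C + σ x ^ 2) S volume :=
      j.add hσ2
    rw [integral_add k hτ1, integral_add j hσ2,
      integral_add (i2.const_mul (1 / 2)) ic, MeasureTheory.integral_const_mul,
      setIntegral_const]
    have : volume.real S = 3 := by
      rw [hS, Real.volume_real_Icc_of_le (by linarith)]; ring
    rw [this, smul_eq_mul]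
    ring
  have hfin : (∫ s in Set.Icc t (t + 1), r s ^ 2) ≤ ∫ x in S, r x ^ 2 * ψ x ^ 2 := by
    rw [setIntegral_congr_fun (g := fun x => r x ^ 2 * ψ x ^ 2) measurableSet_Icc
      (fun x hx => by simp [hone x hx])]
    exact setIntegral_mono_set i2 (ae_of_all _ fun x => by positivity)
      (Set.Icc_subset_Icc (by linarith) (by linarith)).eventuallyLE
  linarith
end
end

section
/- Let σ ∈ L²_unif(ℝ) and τ ∈ L¹_unif(ℝ) be real-valued, and let r ∈ L²_loc(ℝ) be real-valued with r' + r² = σ' + τ in the distributional sense. For n ∈ ℤ set a_n := ∫_n^{n+1} r(t)² dt, and set C := 3‖σ‖_{2,unif} + 3‖τ‖_{1,unif}. Then for every n ∈ ℤ one has a_n ≤ a_{n−1}^{1/2} + a_{n+1}^{1/2} + C. -/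
open MeasureTheory Set Filter Topology intervalIntegral

noncomputable section

/-- The uniform `L²` norm `‖σ‖_{2,unif} = (sup_t ∫_t^{t+1} σ²)^{1/2}`. -/
def norm2unif (σ : ℝ → ℝ) : ℝ :=
  Real.sqrt (⨆ t : ℝ, ∫ s in Set.Icc t (t + 1), σ s ^ 2)

/-- The uniform `L¹` norm `‖τ‖_{1,unif} = sup_t ∫_t^{t+1} |τ|`. -/
def norm1unif (τ : ℝ → ℝ) : ℝ :=
  ⨆ t : ℝ, ∫ s in Set.Icc t (t + 1), |τ s|

lemma exists_step (ε : ℝ) (hε : 0 < ε) : ∃ S g : ℝ → ℝ, ContDiff ℝ (⊤ : ℕ∞) S ∧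
    (∀ x, HasDerivAt S (g x) x) ∧ Continuous g ∧ (∀ x, 0 ≤ g x) ∧ (∀ x, g x ≤ 1 + ε) ∧
    (∀ x, x ∉ Ioo (0:ℝ) 1 → g x = 0) ∧ (∀ x ≤ 0, S x = 0) ∧ (∀ x, 1 ≤ x → S x = 1) ∧
    (∀ x, 0 ≤ S x) ∧ (∀ x, S x ≤ 1) := by
  let b : ContDiffBump (1/2 : ℝ) :=
    { rIn := 1 / (2 * (1 + ε)), rOut := 1 / 2, rIn_pos := by positivity
      rIn_lt_rOut := by
        apply one_div_lt_one_div_of_lt <;> linarith }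
  let g := b.normed volume
  have hgc : Continuous g := b.continuous_normed
  have hg0 : ∀ x, 0 ≤ g x := fun x => b.nonneg_normed x
  have hgi : Integrable g := b.integrable_normed
  have hg1 : ∫ x, g x = 1 := b.integral_normed
  have hgz : ∀ x, x ∉ Ioo (0:ℝ) 1 → g x = 0 := by
    intro x hx
    by_contra h
    have h2 : x ∈ Function.support g := h
    rw [b.support_normed_eq, Real.ball_eq_Ioo] at h2
    apply hx
    simp only [b] at h2
    norm_num at h2
    exact h2
  have hd : ∀ x, HasDerivAt (fun x => ∫ t in (0:ℝ)..x, g t) (g x) x := fun x =>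
    intervalIntegral.integral_hasDerivAt_right (hgc.intervalIntegrable _ _)
      (hgc.stronglyMeasurableAtFilter _ _) hgc.continuousAt
  have hz : ∀ x ≤ 0, ∫ t in (0:ℝ)..x, g t = 0 := by
    intro x hx
    rw [intervalIntegral.integral_congr (g := fun _ => (0:ℝ))]
    · simp
    · intro t ht
      rw [uIcc_of_ge hx] at ht
      exact hgz t (fun h => by linarith [h.1, ht.2])
  refine ⟨fun x => ∫ t in (0:ℝ)..x, g t, g, ?_, hd, hgc, hg0, ?_, hgz, hz, ?_, ?_, ?_⟩
  · rw [contDiff_infty_iff_deriv]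
    refine ⟨fun x => (hd x).differentiableAt, ?_⟩
    rw [show deriv (fun x => ∫ t in (0:ℝ)..x, g t) = g from funext fun x => (hd x).deriv]
    exact b.contDiff_normed
  · intro x
    have h := b.normed_le_div_measure_closedBall_rIn volume x
    rw [Real.volume_real_closedBall b.rIn_pos.le] at h
    refine h.trans (le_of_eq ?_)
    simp only [b]
    field_simp
  · intro x hx
    change ∫ t in (0:ℝ)..x, g t = 1
    rw [intervalIntegral.integral_of_le (by linarith), ← hg1]
    apply setIntegral_eq_integral_of_forall_compl_eq_zero
    intro t ht
    exact hgz t fun h => ht ⟨h.1, by linarith [h.2]⟩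
  · intro x
    rcases le_total x 0 with h | h
    · exact (hz x h).ge
    · exact intervalIntegral.integral_nonneg h fun t _ => hg0 t
  · intro x
    rcases le_total x 0 with h | h
    · exact (hz x h).le.trans zero_le_one
    · change ∫ t in (0:ℝ)..x, g t ≤ 1
      rw [intervalIntegral.integral_of_le h, ← hg1]
      exact setIntegral_le_integral hgi (Eventually.of_forall hg0)

lemma integrableOn_of_sq_s9 {f : ℝ → ℝ} (hm : Measurable f) {u : ℝ}
    (h : IntegrableOn (fun t => f t ^ 2) (Icc u (u + 1))) : IntegrableOn f (Icc u (u + 1)) := by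
  have h1 : IntegrableOn (fun t => 1 + f t ^ 2) (Icc u (u + 1)) :=
    (integrableOn_const (by simp)).add h
  refine Integrable.mono' h1 hm.aestronglyMeasurable (Eventually.of_forall fun t => ?_)
  rw [Real.norm_eq_abs]
  nlinarith [sq_abs (f t), sq_nonneg (|f t| - 1), abs_nonneg (f t)]

lemma abs_le_sqrt_sq {f : ℝ → ℝ} (hm : Measurable f) {u : ℝ}
    (h : IntegrableOn (fun t => f t ^ 2) (Icc u (u + 1))) :
    ∫ t in Icc u (u + 1), |f t| ≤ √(∫ t in Icc u (u + 1), f t ^ 2) := by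
  have h1 : IntegrableOn (fun t => |f t|) (Icc u (u + 1)) := (integrableOn_of_sq_s9 hm h).abs
  set m := ∫ t in Icc u (u + 1), |f t| with hmdef
  apply Real.le_sqrt_of_sq_le
  have h2 : ∫ t in Icc u (u + 1), (2 * m * |f t| - m ^ 2) ≤ ∫ t in Icc u (u + 1), f t ^ 2 := by
    apply integral_mono ((h1.const_mul _).sub (integrableOn_const (by simp))) h
    intro t
    change 2 * m * |f t| - m ^ 2 ≤ f t ^ 2
    nlinarith [sq_abs (f t), sq_nonneg (|f t| - m)]
  rw [integral_sub (h1.const_mul _) (integrableOn_const (by simp)),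
    MeasureTheory.integral_const_mul, ← hmdef] at h2
  simp at h2
  nlinarith

/-- Integral against a function dominated by `K` on two unit intervals, zero elsewhere. -/
lemma abs_integral_mul_le {f ψ : ℝ → ℝ} (hm : Measurable f) {u v K : ℝ} (hK : 0 ≤ K)
    (hu : IntegrableOn (fun t => f t ^ 2) (Icc u (u + 1)))
    (hv : IntegrableOn (fun t => f t ^ 2) (Icc v (v + 1)))
    (hψ : ∀ x, |ψ x| ≤ (Icc u (u + 1)).indicator (fun _ => K) x +
      (Icc v (v + 1)).indicator (fun _ => K) x) :
    |∫ x, f x * ψ x| ≤ K * (√(∫ t in Icc u (u + 1), f t ^ 2) +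
      √(∫ t in Icc v (v + 1), f t ^ 2)) := by
  have iu : Integrable ((Icc u (u + 1)).indicator fun t => |f t|) :=
    (integrable_indicator_iff measurableSet_Icc).2 (integrableOn_of_sq_s9 hm hu).abs
  have iv : Integrable ((Icc v (v + 1)).indicator fun t => |f t|) :=
    (integrable_indicator_iff measurableSet_Icc).2 (integrableOn_of_sq_s9 hm hv).abs
  have h := norm_integral_le_of_norm_le (f := fun x => f x * ψ x) ((iu.add iv).const_mul K)
    (Eventually.of_forall fun x => by
      have := mul_le_mul_of_nonneg_left (hψ x) (abs_nonneg (f x))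
      rw [Real.norm_eq_abs, abs_mul]
      refine this.trans (le_of_eq ?_)
      simp only [Pi.add_apply, indicator]
      split_ifs <;> ring)
  rw [Real.norm_eq_abs, MeasureTheory.integral_const_mul, integral_add' iu iv,
    MeasureTheory.integral_indicator measurableSet_Icc, MeasureTheory.integral_indicator measurableSet_Icc] at h
  refine h.trans (mul_le_mul_of_nonneg_left ?_ hK)
  exact add_le_add (abs_le_sqrt_sq hm hu) (abs_le_sqrt_sq hm hv)

/-- If real-valued `σ ∈ L²_unif(ℝ)`, `τ ∈ L¹_unif(ℝ)` and `r ∈ L²_loc(ℝ)` satisfy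
`r' + r² = σ' + τ` in the distributional sense, then with `aₙ := ∫_n^{n+1} r²` and
`C := 3 ‖σ‖_{2,unif} + 3 ‖τ‖_{1,unif}` one has `aₙ ≤ √a_{n-1} + √a_{n+1} + C` for all
`n ∈ ℤ`. -/
theorem an_recursive_inequality (σ τ r : ℝ → ℝ)
    (hσ : MemL2unif σ) (hτ : MemL1unif τ) (hr : LocL2 r)
    (hricc : ∀ φ : ℝ → ℝ, IsTest φ →
      -(∫ x : ℝ, r x * deriv φ x) + ∫ x : ℝ, r x ^ 2 * φ x
        = -(∫ x : ℝ, σ x * deriv φ x) + ∫ x : ℝ, τ x * φ x)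
    (a : ℤ → ℝ) (ha : ∀ n : ℤ, a n = ∫ t in (n : ℝ)..((n : ℝ) + 1), r t ^ 2)
    (C : ℝ) (hC : C = 3 * norm2unif σ + 3 * norm1unif τ) :
    ∀ n : ℤ, a n ≤ Real.sqrt (a (n - 1)) + Real.sqrt (a (n + 1)) + C := by
  intro n
  obtain ⟨hσm, hσi, M, hM⟩ := hσ
  obtain ⟨hτm, hτi, M', hM'⟩ := hτ
  obtain ⟨hrm, hri⟩ := hr
  have ha' : ∀ k : ℤ, a k = ∫ t in Icc (k:ℝ) (k + 1), r t ^ 2 := by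
    intro k
    rw [ha, intervalIntegral.integral_of_le (by linarith), integral_Icc_eq_integral_Ioc]
  have hσn : ∀ t : ℝ, √(∫ s in Icc t (t + 1), σ s ^ 2) ≤ norm2unif σ := fun t =>
    Real.sqrt_le_sqrt (le_ciSup (f := fun t : ℝ => ∫ s in Icc t (t + 1), σ s ^ 2)
      ⟨M, by rintro _ ⟨t, rfl⟩; exact hM t⟩ t)
  have hτn : ∀ t : ℝ, (∫ s in Icc t (t + 1), |τ s|) ≤ norm1unif τ := fun t =>
    le_ciSup (f := fun t : ℝ => ∫ s in Icc t (t + 1), |τ s|)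
      ⟨M', by rintro _ ⟨t, rfl⟩; exact hM' t⟩ t
  have hσ0 : 0 ≤ norm2unif σ := Real.sqrt_nonneg _
  have key : ∀ ε : ℝ, 0 < ε → a n ≤ (1 + ε) * (√(a (n - 1)) + √(a (n + 1)) + 2 * norm2unif σ)
      + 3 * norm1unif τ := by
    intro ε hε
    obtain ⟨S, g, hS, hd, hgc, hg0, hg1, hgz, hS0, hS1, hSn, hSl⟩ := exists_step ε hε
    let u : ℝ := n - 1
    let v : ℝ := n + 1
    let φ : ℝ → ℝ := fun x => S (x - u) - S (x - v)
    have hφd : ∀ x, deriv φ x = g (x - u) - g (x - v) := fun x =>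
      ((hd (x - u)).comp_sub_const x u |>.sub ((hd (x - v)).comp_sub_const x v)).deriv
    have hφz : ∀ x, x ∉ Icc u (v + 1) → φ x = 0 := by
      intro x hx
      simp only [φ]
      rcases lt_or_ge x u with h | h
      · rw [hS0 _ (by linarith), hS0 _ (by simp only [u, v] at *; linarith)]; simp
      · have : v + 1 < x := by
          by_contra h'
          exact hx ⟨h, not_lt.1 h'⟩
        rw [hS1 _ (by simp only [u, v] at *; linarith), hS1 _ (by linarith)]; simp
    have hφ01 : ∀ x, 0 ≤ φ x ∧ φ x ≤ 1 := by
      intro x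
      refine ⟨?_, by simp only [φ]; linarith [hSn (x - v), hSl (x - u)]⟩
      simp only [φ]
      rcases le_total x v with h | h
      · rw [hS0 (x - v) (by linarith)]; linarith [hSn (x - u)]
      · rw [hS1 (x - u) (by simp only [u, v] at *; linarith)]; linarith [hSl (x - v)]
    have hφ1 : ∀ x ∈ Icc (n:ℝ) (n + 1), φ x = 1 := by
      intro x hx
      simp only [φ]
      rw [hS1 (x - u) (by simp only [u]; linarith [hx.1]),
        hS0 (x - v) (by simp only [v]; linarith [hx.2])]
      simp
    have hφc : ContDiff ℝ (⊤ : ℕ∞) φ :=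
      (hS.comp (contDiff_id.sub contDiff_const)).sub (hS.comp (contDiff_id.sub contDiff_const))
    have ht : IsTest φ := ⟨hφc, HasCompactSupport.intro isCompact_Icc hφz⟩
    have hψ : ∀ x, |deriv φ x| ≤ (Icc u (u + 1)).indicator (fun _ => 1 + ε) x +
        (Icc v (v + 1)).indicator (fun _ => 1 + ε) x := by
      have hone : ∀ w x : ℝ, |g (x - w)| ≤ (Icc w (w + 1)).indicator (fun _ => 1 + ε) x := by
        intro w x
        rw [abs_of_nonneg (hg0 _)]
        by_cases h : x ∈ Icc w (w + 1)
        · rw [indicator_of_mem h]; exact hg1 _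
        · rw [indicator_of_notMem h, hgz]
          rintro ⟨h1, h2⟩
          exact h ⟨by linarith, by linarith⟩
      intro x
      rw [hφd]
      exact (abs_sub _ _).trans (add_le_add (hone u x) (hone v x))
    have e := hricc φ ht
    have hK : 0 ≤ 1 + ε := by linarith
    have e1 := (abs_le.1 (abs_integral_mul_le hrm hK (hri u (u+1)) (hri v (v+1)) hψ)).2
    have e2 := (abs_le.1 (abs_integral_mul_le hσm hK (hσi u) (hσi v) hψ)).1
    have au : a (n - 1) = ∫ t in Icc u (u + 1), r t ^ 2 := by rw [ha']; simp [u]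
    have av : a (n + 1) = ∫ t in Icc v (v + 1), r t ^ 2 := by rw [ha']; simp [v]
    rw [← au, ← av] at e1
    have e2' := mul_le_mul_of_nonneg_left (add_le_add (hσn u) (hσn v)) hK
    -- the quadratic term
    have e3 : a n ≤ ∫ x, r x ^ 2 * φ x := by
      rw [ha', ← MeasureTheory.integral_indicator measurableSet_Icc]
      have i1 : Integrable ((Icc u (v + 1)).indicator fun t => r t ^ 2) :=
        (integrable_indicator_iff measurableSet_Icc).2 (hri _ _)
      apply integral_mono ((integrable_indicator_iff measurableSet_Icc).2 (hri _ _))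
      · refine i1.mono' ((hrm.pow_const 2).mul hφc.continuous.measurable).aestronglyMeasurable
          (Eventually.of_forall fun x => ?_)
        rw [Real.norm_eq_abs, abs_of_nonneg (mul_nonneg (sq_nonneg _) (hφ01 x).1)]
        by_cases h : x ∈ Icc u (v + 1)
        · rw [indicator_of_mem h]
          exact mul_le_of_le_one_right (sq_nonneg _) (hφ01 x).2
        · rw [indicator_of_notMem h, hφz x h, mul_zero]
      · intro x
        change _ ≤ r x ^ 2 * φ x
        by_cases h : x ∈ Icc (n:ℝ) (n + 1)
        · rw [indicator_of_mem h, hφ1 x h, mul_one]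
        · rw [indicator_of_notMem h]
          exact mul_nonneg (sq_nonneg _) (hφ01 x).1
    have e4 : ∫ x, τ x * φ x ≤ 3 * norm1unif τ := by
      have it : ∀ w : ℝ, Integrable ((Icc w (w + 1)).indicator fun t => |τ t|) := fun w =>
        (integrable_indicator_iff measurableSet_Icc).2 (hτi w).abs
      have h := norm_integral_le_of_norm_le (f := fun x => τ x * φ x)
        (((it u).add (it n)).add (it v)) (Eventually.of_forall fun x => by
          rw [Real.norm_eq_abs, abs_mul, abs_of_nonneg (hφ01 x).1]
          have hn : ∀ w : ℝ, 0 ≤ (Icc w (w + 1)).indicator (fun t => |τ t|) x := fun w =>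
            indicator_nonneg (fun _ _ => abs_nonneg _) _
          have hle : |τ x| * φ x ≤ |τ x| := mul_le_of_le_one_right (abs_nonneg _) (hφ01 x).2
          simp only [Pi.add_apply]
          have h1 := hn u
          have h2 := hn n
          have h3 := hn v
          by_cases c : x ∈ Icc u (v + 1)
          · rcases le_total x n with c1 | c1
            · rw [indicator_of_mem (s := Icc u (u + 1))
                ⟨c.1, by simp only [u]; linarith⟩]
              linarith
            · rcases le_total x v with c2 | c2
              · rw [indicator_of_mem (s := Icc (n:ℝ) (n + 1)) ⟨c1, c2⟩]
                linarith
              · rw [indicator_of_mem (s := Icc v (v + 1)) ⟨c2, c.2⟩]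
                linarith
          · rw [hφz x c, mul_zero]
            linarith)
      rw [integral_add' ((it u).add (it n)) (it v), integral_add' (it u) (it n),
        MeasureTheory.integral_indicator measurableSet_Icc, MeasureTheory.integral_indicator measurableSet_Icc,
        MeasureTheory.integral_indicator measurableSet_Icc] at h
      have := le_abs_self (∫ x, τ x * φ x)
      rw [Real.norm_eq_abs] at h
      linarith [hτn u, hτn n, hτn v]
    linarith
  have hfin : a n ≤ √(a (n - 1)) + √(a (n + 1)) + 2 * norm2unif σ + 3 * norm1unif τ := by
    have hA : 0 ≤ √(a (n - 1)) + √(a (n + 1)) + 2 * norm2unif σ := by positivity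
    set A := √(a (n - 1)) + √(a (n + 1)) + 2 * norm2unif σ
    apply le_of_forall_pos_le_add
    intro δ hδ
    have h := key (δ / (A + 1)) (by positivity)
    have h2 : δ / (A + 1) * A ≤ δ := by
      rw [div_mul_eq_mul_div, div_le_iff₀ (by linarith)]
      nlinarith
    linarith
  rw [hC]
  linarith
end
end

section
/- Let σ ∈ L²_unif(ℝ) and τ ∈ L¹_unif(ℝ) be real-valued, let r ∈ L²_loc(ℝ) be real-valued with r' + r² = σ' + τ in the distributional sense, and set C := 3‖σ‖_{2,unif} + 3‖τ‖_{1,unif}. Then for all real a < b with b − a > 3 one has 2 ∫_{a+2}^{b−1} r(t)² dt ≤ C (b − a) + 4. Consequently, with a_n := ∫_n^{n+1} r(t)² dt, both liminf_{n→+∞} a_n ≤ C/2 and liminf_{n→−∞} a_n ≤ C/2 hold. -/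
open MeasureTheory Set Filter Topology intervalIntegral

noncomputable section

lemma aux_cutoff : ∃ S s : ℝ → ℝ, ContDiff ℝ (⊤ : ℕ∞) S ∧ (∀ x, HasDerivAt S (s x) x) ∧
    Continuous s ∧ (∀ x, 0 ≤ s x) ∧ (∀ x, s x ≤ 9 / 8) ∧ (∀ x, x ≤ 0 → s x = 0) ∧
    (∀ x, 1 ≤ x → s x = 0) ∧ Integrable s ∧ (∫ x, s x) = 1 ∧ (∀ x, x ≤ 0 → S x = 0) ∧
    (∀ x, 1 ≤ x → S x = 1) ∧ (∀ x, 0 ≤ S x) ∧ (∀ x, S x ≤ 1) := by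
  let f : ContDiffBump (1 / 2 : ℝ) := ⟨4 / 9, 1 / 2, by norm_num, by norm_num⟩
  obtain ⟨s, hs⟩ : ∃ s : ℝ → ℝ, s = f.normed volume := ⟨_, rfl⟩
  have hcs : ContDiff ℝ (⊤ : ℕ∞) s := by rw [hs]; exact f.contDiff_normed
  have hc : Continuous s := hcs.continuous
  have h0 : ∀ x, 0 ≤ s x := fun x => by rw [hs]; exact f.nonneg_normed x
  have h1 : ∀ x, s x ≤ 9 / 8 := fun x => by
    rw [hs]
    refine (f.normed_le_div_measure_closedBall_rIn volume x).trans ?_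
    have : f.rIn = 4 / 9 := rfl
    rw [this, Real.volume_real_closedBall (by norm_num)]
    norm_num
  have hz : ∀ x, (x ≤ 0 ∨ 1 ≤ x) → s x = 0 := fun x hx => by
    by_contra hne
    have : x ∈ Function.support (f.normed volume) := by rw [← hs]; exact hne
    rw [f.support_normed_eq] at this
    have h2 : f.rOut = 1 / 2 := rfl
    rw [h2, Real.ball_eq_Ioo] at this
    rcases this with ⟨h3, h4⟩
    rcases hx with h | h <;> linarith
  have hi : Integrable s := by rw [hs]; exact f.integrable_normed
  have hI : (∫ x, s x) = 1 := by rw [hs]; exact f.integral_normed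
  obtain ⟨S, hS⟩ : ∃ S : ℝ → ℝ, S = fun x => ∫ y in (0 : ℝ)..x, s y := ⟨_, rfl⟩
  have hd : ∀ x, HasDerivAt S (s x) x := fun x => by
    rw [hS]
    exact hc.integral_hasStrictDerivAt 0 x |>.hasDerivAt
  have hder : deriv S = s := funext fun x => (hd x).deriv
  have hS0 : ∀ x, x ≤ 0 → S x = 0 := fun x hx => by
    rw [hS]
    simp only
    rw [intervalIntegral.integral_symm, intervalIntegral.integral_of_le hx,
      setIntegral_eq_zero_of_forall_eq_zero, neg_zero]
    intro y hy
    exact hz y (Or.inl hy.2)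
  have hS1 : ∀ x, 1 ≤ x → S x = 1 := fun x hx => by
    rw [hS]
    simp only
    rw [intervalIntegral.integral_of_le (by linarith), setIntegral_eq_integral_of_forall_compl_eq_zero, hI]
    intro y hy
    apply hz y
    by_contra hcon
    push Not at hcon
    exact hy ⟨hcon.1, by linarith [hcon.2]⟩
  have hm : Monotone S := monotone_of_deriv_nonneg (fun x => (hd x).differentiableAt)
    (fun x => by rw [hder]; exact h0 x)
  refine ⟨S, s, ?_, hd, hc, h0, h1, fun x hx => hz x (Or.inl hx), fun x hx => hz x (Or.inr hx),
    hi, hI, hS0, hS1, ?_, ?_⟩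
  · refine contDiff_infty_iff_deriv.2 ⟨fun x => (hd x).differentiableAt, ?_⟩
    rw [hder]; exact hcs
  · intro x
    rw [← hS0 (min x 0) (min_le_right _ _)]
    exact hm (min_le_left _ _)
  · intro x
    rw [← hS1 (max x 1) (le_max_right _ _)]
    exact hm (le_max_left _ _)

lemma aux_locint {f : ℝ → ℝ} (h : ∀ t : ℝ, IntegrableOn f (Set.Icc t (t + 1)) volume) :
    LocallyIntegrable f := by
  intro x
  refine ⟨Set.Icc (x - 1 / 2) (x - 1 / 2 + 1), Icc_mem_nhds (by linarith) (by linarith), h _⟩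

lemma aux_locint_sq {f : ℝ → ℝ} (hm : Measurable f) (h : LocallyIntegrable (fun t => f t ^ 2)) :
    LocallyIntegrable f := by
  refine LocallyIntegrable.mono (f := fun t => 1 + f t ^ 2) ((locallyIntegrable_const 1).add h)
    hm.aestronglyMeasurable (Eventually.of_forall fun x => ?_)
  rw [Real.norm_eq_abs, Real.norm_eq_abs, abs_of_nonneg (by positivity : 0 ≤ 1 + f x ^ 2)]
  rw [← sq_abs]
  nlinarith [sq_nonneg (|f x| - 1), abs_nonneg (f x)]

lemma aux_norm1 {τ : ℝ → ℝ} (hτ : MemL1unif τ) :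
    0 ≤ norm1unif τ ∧ ∀ t, (∫ s in Set.Icc t (t + 1), |τ s|) ≤ norm1unif τ := by
  obtain ⟨-, -, M, hM⟩ := hτ
  have h : ∀ t, (∫ s in Set.Icc t (t + 1), |τ s|) ≤ norm1unif τ := fun t =>
    le_ciSup (f := fun t => ∫ s in Set.Icc t (t + 1), |τ s|)
      ⟨M, by rintro _ ⟨t, rfl⟩; exact hM t⟩ t
  exact ⟨le_trans (integral_nonneg fun _ => abs_nonneg _) (h 0), h⟩

lemma aux_norm2 {σ : ℝ → ℝ} (hσ : MemL2unif σ) :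
    0 ≤ norm2unif σ ∧ ∀ t, (∫ s in Set.Icc t (t + 1), |σ s|) ≤ norm2unif σ := by
  obtain ⟨hm, hi, M, hM⟩ := hσ
  refine ⟨Real.sqrt_nonneg _, fun t => ?_⟩
  have h : (∫ s in Set.Icc t (t + 1), σ s ^ 2) ≤ ⨆ t : ℝ, ∫ s in Set.Icc t (t + 1), σ s ^ 2 :=
    le_ciSup (f := fun t => ∫ s in Set.Icc t (t + 1), σ s ^ 2)
      ⟨M, by rintro _ ⟨t, rfl⟩; exact hM t⟩ t
  refine Real.le_sqrt_of_sq_le (le_trans ?_ h)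
  have hl : IntegrableOn (fun s => |σ s|) (Set.Icc t (t + 1)) :=
    ((aux_locint_sq hm (aux_locint hi)).integrableOn_isCompact isCompact_Icc).abs
  set m := ∫ s in Set.Icc t (t + 1), |σ s| with hmdef
  have hle : (∫ s in Set.Icc t (t + 1), (2 * m * |σ s| - m ^ 2))
      ≤ ∫ s in Set.Icc t (t + 1), σ s ^ 2 := by
    refine integral_mono ((hl.const_mul _).sub (integrable_const _)) (hi t) fun s => ?_
    simp only
    rw [← sq_abs (σ s)]
    nlinarith [sq_nonneg (|σ s| - m)]
  rw [integral_sub (hl.const_mul _) (integrable_const _), MeasureTheory.integral_const_mul, ← hmdef] at hle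
  simp at hle
  nlinarith

lemma aux_long {f : ℝ → ℝ} (hf : LocallyIntegrable f) (h0 : ∀ x, 0 ≤ f x) {N : ℝ}
    (hN : ∀ t, (∫ s in Set.Icc t (t + 1), f s) ≤ N) (n : ℕ) (a : ℝ) :
    (∫ s in Set.Icc a (a + n), f s) ≤ n * N := by
  induction n with
  | zero => simp
  | succ n ih =>
    have hi : ∀ x y, IntervalIntegrable f volume x y := fun x y =>
      (hf.integrableOn_isCompact isCompact_uIcc).intervalIntegrable
    have h2 := hN (a + n)
    have hn : (0 : ℝ) ≤ n := Nat.cast_nonneg n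
    push_cast
    rw [integral_Icc_eq_integral_Ioc, ← intervalIntegral.integral_of_le (by linarith)] at *
    rw [← intervalIntegral.integral_add_adjacent_intervals (hi a (a + n)) (hi _ _)]
    rw [← add_assoc] 
    linarith

lemma aux_real {f : ℝ → ℝ} (hf : LocallyIntegrable f) (h0 : ∀ x, 0 ≤ f x) {N : ℝ} (hN0 : 0 ≤ N)
    (hN : ∀ t, (∫ s in Set.Icc t (t + 1), f s) ≤ N) {a b : ℝ} (hab : a ≤ b) :
    (∫ s in Set.Icc a b, f s) ≤ (b - a + 1) * N := by
  have h1 : b ≤ a + (⌈b - a⌉₊ : ℝ) := by linarith [Nat.le_ceil (b - a)]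
  have h2 : (⌈b - a⌉₊ : ℝ) < b - a + 1 := Nat.ceil_lt_add_one (by linarith)
  calc (∫ s in Set.Icc a b, f s) ≤ ∫ s in Set.Icc a (a + (⌈b - a⌉₊ : ℝ)), f s :=
        setIntegral_mono_set (hf.integrableOn_isCompact isCompact_Icc)
          (Eventually.of_forall h0) (Eventually.of_forall (Set.Icc_subset_Icc_right h1))
    _ ≤ ⌈b - a⌉₊ * N := aux_long hf h0 hN _ _
    _ ≤ _ := by gcongr

lemma aux_main (σ τ r : ℝ → ℝ)
    (hσ : MemL2unif σ) (hτ : MemL1unif τ) (hr : LocL2 r)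
    (hricc : ∀ φ : ℝ → ℝ, IsTest φ →
      -(∫ x : ℝ, r x * deriv φ x) + ∫ x : ℝ, r x ^ 2 * φ x
        = -(∫ x : ℝ, σ x * deriv φ x) + ∫ x : ℝ, τ x * φ x)
    (a b : ℝ) (hab : 3 < b - a) :
    2 * ∫ t in (a + 2)..(b - 1), r t ^ 2 ≤ (3 * norm2unif σ + 3 * norm1unif τ) * (b - a) + 4 := by
  obtain ⟨S, s, hSc, hd, hsc, hs0, hs1, hsl, hsr, hsi, hsI, hSl, hSr, hS0, hS1⟩ := aux_cutoff
  obtain ⟨hN2, hσN⟩ := aux_norm2 hσ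
  obtain ⟨hN1, hτN⟩ := aux_norm1 hτ
  have lr2 : LocallyIntegrable (fun t => r t ^ 2) := aux_locint fun t => hr.2 _ _
  have lr : LocallyIntegrable r := aux_locint_sq hr.1 lr2
  have lσ : LocallyIntegrable σ := aux_locint_sq hσ.1 (aux_locint hσ.2.1)
  have lτ : LocallyIntegrable τ := aux_locint hτ.2.1
  have lσa : LocallyIntegrable (fun t => |σ t|) :=
    lσ.mono hσ.1.abs.aestronglyMeasurable (Eventually.of_forall fun x => by simp)
  have lτa : LocallyIntegrable (fun t => |τ t|) :=
    lτ.mono hτ.1.abs.aestronglyMeasurable (Eventually.of_forall fun x => by simp)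
  obtain ⟨p, hp⟩ : ∃ p : ℝ → ℝ, p = fun t => s ((t - a) / 2) / 2 := ⟨_, rfl⟩
  obtain ⟨q, hq⟩ : ∃ q : ℝ → ℝ, q = fun t => s (b - t) := ⟨_, rfl⟩
  obtain ⟨η, hη⟩ : ∃ η : ℝ → ℝ, η = fun t => S ((t - a) / 2) + S (b - t) - 1 := ⟨_, rfl⟩
  have hηd : ∀ t, HasDerivAt η (p t - q t) t := fun t => by
    have h1 : HasDerivAt (fun t => S ((t - a) / 2)) (s ((t - a) / 2) * (1 / 2)) t :=
      (hd _).comp t (((hasDerivAt_id t).sub_const a).div_const 2)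
    have h2 : HasDerivAt (fun t => S (b - t)) (s (b - t) * (-1)) t :=
      (hd _).comp t ((hasDerivAt_id t).const_sub b)
    rw [hη, hp, hq]
    exact ((h1.add h2).sub_const 1).congr_deriv (by ring)
  have hηc : ContDiff ℝ (⊤ : ℕ∞) η := by
    rw [hη]
    exact ((hSc.comp ((contDiff_id.sub contDiff_const).div_const 2)).add
      (hSc.comp (contDiff_const.sub contDiff_id))).sub contDiff_const
  have hη0 : ∀ t, 0 ≤ η t := fun t => by
    rw [hη]; simp only
    rcases le_total t (b - 1) with h | h
    · rw [hSr (b - t) (by linarith)]; linarith [hS0 ((t - a) / 2)]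
    · rw [hSr ((t - a) / 2) (by linarith)]; linarith [hS0 (b - t)]
  have hη1 : ∀ t, η t ≤ 1 := fun t => by
    rw [hη]; simp only
    linarith [hS1 ((t - a) / 2), hS1 (b - t)]
  have hηz : ∀ t, t ∉ Set.Icc a b → η t = 0 := fun t ht => by
    rw [hη]; simp only
    rcases lt_or_ge t a with h | h
    · rw [hSr (b - t) (by linarith), hSl _ (by linarith)]; ring
    · have : b < t := by
        by_contra hcon
        exact ht ⟨h, by linarith⟩
      rw [hSr ((t - a) / 2) (by linarith), hSl _ (by linarith)]; ring
  have hηm : ∀ t ∈ Set.Icc (a + 2) (b - 1), η t = 1 ∧ p t = 0 ∧ q t = 0 := fun t ht => by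
    rw [hη, hp, hq]; simp only
    rw [hSr ((t - a) / 2) (by linarith [ht.1]), hSr (b - t) (by linarith [ht.2]),
      hsr ((t - a) / 2) (by linarith [ht.1]), hsr (b - t) (by linarith [ht.2])]
    norm_num
  have hp0 : ∀ t, 0 ≤ p t := fun t => by rw [hp]; simp only; linarith [hs0 ((t - a) / 2)]
  have hq0 : ∀ t, 0 ≤ q t := fun t => by rw [hq]; exact hs0 _
  have hp1 : ∀ t, p t ≤ 9 / 16 := fun t => by rw [hp]; simp only; linarith [hs1 ((t - a) / 2)]
  have hq1 : ∀ t, q t ≤ 9 / 8 := fun t => by rw [hq]; exact hs1 _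
  have hpz : ∀ t, t ∉ Set.Icc a (a + 2) → p t = 0 := fun t ht => by
    rw [hp]; simp only
    rcases lt_or_ge t a with h | h
    · rw [hsl _ (by linarith)]; simp
    · have : a + 2 < t := by
        by_contra hcon
        exact ht ⟨h, by linarith⟩
      rw [hsr _ (by linarith)]; simp
  have hqz : ∀ t, t ∉ Set.Icc (b - 1) b → q t = 0 := fun t ht => by
    rw [hq]; simp only
    rcases lt_or_ge t (b - 1) with h | h
    · rw [hsr _ (by linarith)]
    · have : b < t := by
        by_contra hcon
        exact ht ⟨h, by linarith⟩
      rw [hsl _ (by linarith)]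
  have hpi : Integrable p := by
    rw [hp]
    exact ((hsi.comp_div (by norm_num : (2 : ℝ) ≠ 0)).comp_sub_right a).div_const 2
  have hqi : Integrable q := by
    rw [hq]; exact hsi.comp_sub_left b
  have hpI : (∫ t, p t) = 1 := by
    rw [hp, MeasureTheory.integral_div, integral_sub_right_eq_self (fun t => s (t / 2)) a,
      Measure.integral_comp_div, hsI]
    norm_num
  have hqI : (∫ t, q t) = 1 := by
    rw [hq, integral_sub_left_eq_self, hsI]
  obtain ⟨φ, hφ⟩ : ∃ φ : ℝ → ℝ, φ = fun t => η t ^ 2 := ⟨_, rfl⟩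
  have hφd : deriv φ = fun t => 2 * η t * (p t - q t) := by
    funext t
    rw [hφ]
    have := ((hηd t).pow 2).deriv
    rw [show (fun t => η t ^ 2) = η ^ 2 from rfl, this]
    simp
  have hφc : ContDiff ℝ (⊤ : ℕ∞) φ := by rw [hφ]; exact hηc.pow 2
  have hφs : HasCompactSupport φ := HasCompactSupport.intro isCompact_Icc
    (fun t ht => by rw [hφ]; simp [hηz t ht] : ∀ t, t ∉ Set.Icc a b → φ t = 0)
  have hφ's : HasCompactSupport (deriv φ) := hφs.deriv
  have hφ'c : Continuous (deriv φ) := (contDiff_infty_iff_deriv.1 hφc).2.continuous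
  have i1 : Integrable (fun x => r x * deriv φ x) :=
    lr.integrable_smul_right_of_hasCompactSupport hφ'c hφ's
  have i2 : Integrable (fun x => r x ^ 2 * φ x) :=
    lr2.integrable_smul_right_of_hasCompactSupport hφc.continuous hφs
  have i3 : Integrable (fun x => σ x * deriv φ x) :=
    lσ.integrable_smul_right_of_hasCompactSupport hφ'c hφ's
  have i4 : Integrable (fun x => τ x * φ x) :=
    lτ.integrable_smul_right_of_hasCompactSupport hφc.continuous hφs
  have key := hricc φ ⟨hφc, hφs⟩
  -- lower bound
  have j1 : Integrable ((Set.Icc (a + 2) (b - 1)).indicator (fun t => r t ^ 2)) :=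
    (lr2.integrableOn_isCompact isCompact_Icc).integrable_indicator measurableSet_Icc
  have j2 : Integrable (fun t => 9 / 16 * p t + 9 / 8 * q t) :=
    (hpi.const_mul _).add (hqi.const_mul _)
  have low : (∫ t in Set.Icc (a + 2) (b - 1), r t ^ 2) - (9 / 16 + 9 / 8)
      ≤ (∫ x, r x ^ 2 * φ x) - ∫ x, r x * deriv φ x := by
    have e2 : (∫ t, (9 / 16 * p t + 9 / 8 * q t)) = 9 / 16 + 9 / 8 := by
      rw [integral_add (hpi.const_mul _) (hqi.const_mul _), MeasureTheory.integral_const_mul,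
        MeasureTheory.integral_const_mul, hpI, hqI]
      norm_num
    rw [← e2, ← MeasureTheory.integral_indicator measurableSet_Icc, ← integral_sub j1 j2, ← integral_sub i2 i1]
    refine integral_mono (j1.sub j2) (i2.sub i1) fun t => ?_
    simp only [hφd]
    rw [hφ]
    by_cases ht : t ∈ Set.Icc (a + 2) (b - 1)
    · obtain ⟨h1, h2, h3⟩ := hηm t ht
      simp [Set.indicator_of_mem ht, h1, h2, h3]
    · rw [Set.indicator_of_notMem ht]
      have u1 : p t * p t ≤ 9 / 16 * p t := mul_le_mul_of_nonneg_right (hp1 t) (hp0 t)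
      have u2 : q t * q t ≤ 9 / 8 * q t := mul_le_mul_of_nonneg_right (hq1 t) (hq0 t)
      have u3 := mul_nonneg (hp0 t) (hq0 t)
      nlinarith [sq_nonneg (r t * η t - (p t - q t))]
  -- upper bound
  have k1 : Integrable ((Set.Icc a (a + 2)).indicator (fun t => |σ t|)) :=
    (lσa.integrableOn_isCompact isCompact_Icc).integrable_indicator measurableSet_Icc
  have k2 : Integrable ((Set.Icc (b - 1) b).indicator (fun t => |σ t|)) :=
    (lσa.integrableOn_isCompact isCompact_Icc).integrable_indicator measurableSet_Icc
  have k3 : Integrable ((Set.Icc a b).indicator (fun t => |τ t|)) :=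
    (lτa.integrableOn_isCompact isCompact_Icc).integrable_indicator measurableSet_Icc
  have upσ : -(∫ x, σ x * deriv φ x) ≤ 9 / 8 * (∫ t in Set.Icc a (a + 2), |σ t|)
      + 9 / 4 * ∫ t in Set.Icc (b - 1) b, |σ t| := by
    rw [← MeasureTheory.integral_neg, ← MeasureTheory.integral_indicator measurableSet_Icc,
      ← MeasureTheory.integral_indicator measurableSet_Icc, ← MeasureTheory.integral_const_mul, ← MeasureTheory.integral_const_mul,
      ← integral_add (k1.const_mul _) (k2.const_mul _)]
    refine integral_mono i3.neg ((k1.const_mul _).add (k2.const_mul _)) fun t => ?_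
    have g1 : |σ t| * p t ≤ 9 / 16 * (Set.Icc a (a + 2)).indicator (fun t => |σ t|) t := by
      by_cases ht : t ∈ Set.Icc a (a + 2)
      · rw [Set.indicator_of_mem ht]
        nlinarith [mul_le_mul_of_nonneg_left (hp1 t) (abs_nonneg (σ t))]
      · rw [Set.indicator_of_notMem ht, hpz t ht]; simp
    have g2 : |σ t| * q t ≤ 9 / 8 * (Set.Icc (b - 1) b).indicator (fun t => |σ t|) t := by
      by_cases ht : t ∈ Set.Icc (b - 1) b
      · rw [Set.indicator_of_mem ht]
        nlinarith [mul_le_mul_of_nonneg_left (hq1 t) (abs_nonneg (σ t))]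
      · rw [Set.indicator_of_notMem ht, hqz t ht]; simp
    have g3 : -(σ t * (p t - q t)) ≤ |σ t| * (p t + q t) := by
      have := hp0 t
      have := hq0 t
      calc -(σ t * (p t - q t)) ≤ |σ t * (p t - q t)| := neg_le_abs _
        _ = |σ t| * |p t - q t| := abs_mul _ _
        _ ≤ |σ t| * (p t + q t) := by
          gcongr
          rw [abs_le]; constructor <;> linarith
    have g4 : 0 ≤ |σ t| * (p t + q t) :=
      mul_nonneg (abs_nonneg _) (add_nonneg (hp0 t) (hq0 t))
    have g5 : -(σ t * (p t - q t)) * η t ≤ |σ t| * (p t + q t) :=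
      calc _ ≤ |σ t| * (p t + q t) * η t := mul_le_mul_of_nonneg_right g3 (hη0 t)
        _ ≤ |σ t| * (p t + q t) * 1 := mul_le_mul_of_nonneg_left (hη1 t) g4
        _ = _ := mul_one _
    simp only [hφd]
    nlinarith
  have upτ : (∫ x, τ x * φ x) ≤ ∫ t in Set.Icc a b, |τ t| := by
    rw [← MeasureTheory.integral_indicator measurableSet_Icc]
    refine integral_mono i4 k3 fun t => ?_
    simp only [hφ]
    by_cases ht : t ∈ Set.Icc a b
    · rw [Set.indicator_of_mem ht]
      have : η t ^ 2 ≤ 1 := pow_le_one₀ (hη0 t) (hη1 t)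
      calc τ t * η t ^ 2 ≤ |τ t| * η t ^ 2 := by gcongr; exact le_abs_self _
        _ ≤ |τ t| * 1 := by gcongr
        _ = _ := mul_one _
    · rw [Set.indicator_of_notMem ht, hηz t ht]; simp
  have b1 : (∫ t in Set.Icc a (a + 2), |σ t|) ≤ 2 * norm2unif σ := by
    have := aux_long lσa (fun _ => abs_nonneg _) hσN 2 a
    simpa using this
  have b2 : (∫ t in Set.Icc (b - 1) b, |σ t|) ≤ norm2unif σ := by
    have := hσN (b - 1)
    simpa using this
  have b3 : (∫ t in Set.Icc a b, |τ t|) ≤ (b - a + 1) * norm1unif τ :=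
    aux_real lτa (fun _ => abs_nonneg _) hN1 hτN (by linarith)
  rw [intervalIntegral.integral_of_le (by linarith), ← integral_Icc_eq_integral_Ioc]
  nlinarith [mul_nonneg hN2 (by linarith : 0 ≤ b - a - 3),
    mul_nonneg hN1 (by linarith : 0 ≤ b - a - 3)]

lemma aux_sum {f : ℝ → ℝ} (hf : LocallyIntegrable f) {A : ℝ} (k : ℤ) (m : ℕ)
    (h : ∀ n : ℤ, k ≤ n → n < k + m → A ≤ ∫ t in (n : ℝ)..((n : ℝ) + 1), f t) :
    m * A ≤ ∫ t in (k : ℝ)..((k : ℝ) + m), f t := by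
  induction m with
  | zero => simp
  | succ m ih =>
    have hi : ∀ x y, IntervalIntegrable f volume x y := fun x y =>
      (hf.integrableOn_isCompact isCompact_uIcc).intervalIntegrable
    have h1 := ih fun n h1 h2 => h n h1 (by push_cast; linarith)
    have h2 := h (k + m) (by omega) (by push_cast; omega)
    push_cast at h2 ⊢
    rw [← intervalIntegral.integral_add_adjacent_intervals (hi k (k + m)) (hi _ _), ← add_assoc]
    linarith

/-- If real-valued `σ ∈ L²_unif(ℝ)`, `τ ∈ L¹_unif(ℝ)` and `r ∈ L²_loc(ℝ)` satisfy
`r' + r² = σ' + τ` distributionally, and `C := 3 ‖σ‖_{2,unif} + 3 ‖τ‖_{1,unif}`, then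
`2 ∫_{a+2}^{b-1} r² ≤ C (b - a) + 4` whenever `b - a > 3`; consequently, with
`aₙ := ∫_n^{n+1} r²`, both `liminf_{n → +∞} aₙ ≤ C/2` and `liminf_{n → -∞} aₙ ≤ C/2`
(expressed by: for every `ε > 0`, frequently `aₙ < C/2 + ε` as `n → ±∞`). -/
theorem averaged_riccati_bound_and_liminf (σ τ r : ℝ → ℝ)
    (hσ : MemL2unif σ) (hτ : MemL1unif τ) (hr : LocL2 r)
    (hricc : ∀ φ : ℝ → ℝ, IsTest φ →
      -(∫ x : ℝ, r x * deriv φ x) + ∫ x : ℝ, r x ^ 2 * φ x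
        = -(∫ x : ℝ, σ x * deriv φ x) + ∫ x : ℝ, τ x * φ x)
    (C : ℝ) (hC : C = 3 * norm2unif σ + 3 * norm1unif τ) :
    (∀ a b : ℝ, 3 < b - a →
      2 * ∫ t in (a + 2)..(b - 1), r t ^ 2 ≤ C * (b - a) + 4) ∧
    (∀ ε : ℝ, 0 < ε →
      ∃ᶠ n : ℤ in atTop, (∫ t in (n : ℝ)..((n : ℝ) + 1), r t ^ 2) < C / 2 + ε) ∧
    (∀ ε : ℝ, 0 < ε →
      ∃ᶠ n : ℤ in atBot, (∫ t in (n : ℝ)..((n : ℝ) + 1), r t ^ 2) < C / 2 + ε) := by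
  have hmain : ∀ a b : ℝ, 3 < b - a →
      2 * ∫ t in (a + 2)..(b - 1), r t ^ 2 ≤ C * (b - a) + 4 := by
    rw [hC]
    exact aux_main σ τ r hσ hτ hr hricc
  have lr2 : LocallyIntegrable (fun t => r t ^ 2) := aux_locint fun t => hr.2 _ _
  have hcontra : ∀ ε : ℝ, 0 < ε → ∃ m : ℕ, ∀ k : ℤ,
      ¬ ∀ n : ℤ, k ≤ n → n < k + m → C / 2 + ε ≤ ∫ t in (n : ℝ)..((n : ℝ) + 1), r t ^ 2 := by
    intro ε hε
    obtain ⟨m, hm⟩ := exists_nat_gt (max 1 ((3 * C + 4) / (2 * ε)))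
    refine ⟨m, fun k hk => ?_⟩
    have hm1 : (1 : ℝ) < m := lt_of_le_of_lt (le_max_left _ _) hm
    have hm2 : (3 * C + 4) / (2 * ε) < m := lt_of_le_of_lt (le_max_right _ _) hm
    rw [div_lt_iff₀ (by positivity)] at hm2
    have h1 := aux_sum lr2 k m hk
    have h2 := hmain (k - 2) (k + m + 1) (by linarith)
    rw [show (k : ℝ) - 2 + 2 = k by ring, show (k : ℝ) + m + 1 - 1 = k + m by ring] at h2
    nlinarith
  refine ⟨hmain, fun ε hε => ?_, fun ε hε => ?_⟩
  · obtain ⟨m, hm⟩ := hcontra ε hε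
    rw [frequently_atTop]
    intro N
    by_contra hcon
    push Not at hcon
    exact hm N fun n h1 _ => hcon n h1
  · obtain ⟨m, hm⟩ := hcontra ε hε
    rw [frequently_atBot]
    intro N
    by_contra hcon
    push Not at hcon
    exact hm (N - m) fun n _ h2 => hcon n (by omega)
end
end

section
/- Let C > 0 and let (a_n)_{n∈ℤ} be a sequence of nonnegative real numbers such that a_n ≤ a_{n−1}^{1/2} + a_{n+1}^{1/2} + C for all n ∈ ℤ. Suppose there exist integer sequences n_k^- → −∞ and n_k^+ → +∞ with a_{n_k^-} < C and a_{n_k^+} < C for all k. Then sup_{n∈ℤ} a_n ≤ 2C + 4. -/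
open Filter Topology

/-- Discrete maximum principle: let `C > 0` and let `(aₙ)_{n ∈ ℤ}` be nonnegative reals
with `aₙ ≤ √a_{n-1} + √a_{n+1} + C` for all `n`. If there are integer sequences
`n⁻ₖ → -∞` and `n⁺ₖ → +∞` with `a_{n⁻ₖ} < C` and `a_{n⁺ₖ} < C` for all `k`, then
`sup_{n ∈ ℤ} aₙ ≤ 2C + 4`. -/
theorem discrete_maximum_principle (C : ℝ) (hC : 0 < C) (a : ℤ → ℝ)
    (hnonneg : ∀ n : ℤ, 0 ≤ a n)
    (hrec : ∀ n : ℤ, a n ≤ Real.sqrt (a (n - 1)) + Real.sqrt (a (n + 1)) + C)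
    (nm np : ℕ → ℤ)
    (hnm : Tendsto nm atTop atBot) (hnp : Tendsto np atTop atTop)
    (ham : ∀ k : ℕ, a (nm k) < C) (hap : ∀ k : ℕ, a (np k) < C) :
    ∀ n : ℤ, a n ≤ 2 * C + 4 := by
  intro n
  obtain ⟨i, hi⟩ := (hnm.eventually_le_atBot n).exists
  obtain ⟨j, hj⟩ := (hnp.eventually_ge_atTop n).exists
  obtain ⟨m, hm, hmax⟩ := Finset.exists_max_image (Finset.Icc (nm i) (np j)) a
    ⟨n, Finset.mem_Icc.2 ⟨hi, hj⟩⟩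
  refine (hmax n (Finset.mem_Icc.2 ⟨hi, hj⟩)).trans ?_
  rw [Finset.mem_Icc] at hm
  by_cases h1 : m = nm i
  · have := ham i
    rw [h1]
    linarith
  by_cases h2 : m = np j
  · have := hap j
    rw [h2]
    linarith
  have e1 := Real.sqrt_le_sqrt (hmax (m - 1) (Finset.mem_Icc.2 ⟨by omega, by omega⟩))
  have e2 := Real.sqrt_le_sqrt (hmax (m + 1) (Finset.mem_Icc.2 ⟨by omega, by omega⟩))
  have e3 := hrec m
  have e4 := Real.sq_sqrt (hnonneg m)
  nlinarith [sq_nonneg (Real.sqrt (a m) - 2)]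
end
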